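/- The operators L(n), n ≥ −1, satisfy the Virasoro relations without central term: for all integers m, n ≥ −1, L(m) ∘ L(n) − L(n) ∘ L(m) = (m−n)·L(m+n) as ℂ-linear endomorphisms of R (Theorem 3.3; consequently the vertex algebra M(l) is quasi-conformal). -/

import Mathlib

open MvPolynomial

/-- Value of the operator `L(n)` on the monomial `X^e`, in the polynomial realization of `M(l)`:
`L(n) = (l/2)·∑_{i,j} ∑_{m=1}^{n-1} m(n-m)·∂_{i,j,m}∘∂_{i,j,n-m}
        + ∑_{i,j} ∑_{m ≥ max(1,n+1)} m·X_{i,j,m-n}∘∂_{i,j,m}`;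
on a fixed monomial only finitely many summands are nonzero, namely those whose rightmost
derivative variable lies in the support of `e`. -/
noncomputable def LnMono (d : ℕ) (l : ℂ) (n : ℤ)
    (e : (Fin d × ℕ × ℕ+) →₀ ℕ) : MvPolynomial (Fin d × ℕ × ℕ+) ℂ :=
  (l / 2) • (∑ v ∈ e.support,
      if h : ((v.2.2 : ℕ) : ℤ) < n then
        (((n - ((v.2.2 : ℕ) : ℤ)) * ((v.2.2 : ℕ) : ℤ) : ℤ) : ℂ) •
          pderiv (((v.1, v.2.1, ⟨(n - ((v.2.2 : ℕ) : ℤ)).toNat, by omega⟩) : Fin d × ℕ × ℕ+))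
            (pderiv v (monomial e (1 : ℂ)))
      else 0)
  + ∑ v ∈ e.support,
      if h : n < ((v.2.2 : ℕ) : ℤ) then
        (((v.2.2 : ℕ) : ℤ) : ℂ) •
          ((X (v.1, v.2.1, (⟨(((v.2.2 : ℕ) : ℤ) - n).toNat, by omega⟩ : ℕ+)) : MvPolynomial (Fin d × ℕ × ℕ+) ℂ) *
            pderiv v (monomial e (1 : ℂ)))
      else 0

/-- The operator `L(n)` (for any `n : ℤ`; only `n ≥ -1` is used) on the polynomial
realization `R = MvPolynomial (Fin d × ℕ × ℕ+) ℂ` of `M(l)`, defined on the monomial basis. -/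
noncomputable def Ln (d : ℕ) (l : ℂ) (n : ℤ) :
    Module.End ℂ (MvPolynomial (Fin d × ℕ × ℕ+) ℂ) :=
  (basisMonomials (Fin d × ℕ × ℕ+) ℂ).constr ℂ (LnMono d l n)


/-- partial derivative with integer index, zero for nonpositive index -/
noncomputable def DD (d : ℕ) (i : Fin d) (j : ℕ) (k : ℤ) :
    Module.End ℂ (MvPolynomial (Fin d × ℕ × ℕ+) ℂ) :=
  if 0 < k then (pderiv (i, j, k.toNat.toPNat')).toLinearMap else 0

noncomputable def MM (d : ℕ) (i : Fin d) (j : ℕ) (k : ℤ) : MvPolynomial (Fin d × ℕ × ℕ+) ℂ :=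
  if 0 < k then X (i, j, k.toNat.toPNat') else 0

lemma DD_pos (d : ℕ) (i : Fin d) (j : ℕ) (k : ℕ+) (p : MvPolynomial (Fin d × ℕ × ℕ+) ℂ) :
    DD d i j ((k : ℕ) : ℤ) p = pderiv (i, j, k) p := by
  have : (0 : ℤ) < ((k : ℕ) : ℤ) := by exact_mod_cast k.pos
  simp [DD]

lemma DD_neg (d : ℕ) (i : Fin d) (j : ℕ) (k : ℤ) (hk : k ≤ 0) : DD d i j k = 0 := by
  simp [DD, not_lt.mpr hk]

lemma MM_pos (d : ℕ) (i : Fin d) (j : ℕ) (k : ℕ+) :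
    MM d i j ((k : ℕ) : ℤ) = X (i, j, k) := by
  have : (0 : ℤ) < ((k : ℕ) : ℤ) := by exact_mod_cast k.pos
  simp [MM]

lemma MM_neg (d : ℕ) (i : Fin d) (j : ℕ) (k : ℤ) (hk : k ≤ 0) : MM d i j k = 0 := by
  simp [MM, not_lt.mpr hk]

lemma DD_mk (d : ℕ) (i : Fin d) (j : ℕ) (k : ℤ) (h : 0 < k.toNat)
    (p : MvPolynomial (Fin d × ℕ × ℕ+) ℂ) :
    DD d i j k p = pderiv (i, j, (⟨k.toNat, h⟩ : ℕ+)) p := by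
  have e : k.toNat.toPNat' = (⟨k.toNat, h⟩ : ℕ+) := by
    apply PNat.eq; simp [h]
  have hk : 0 < k := by omega
  rw [DD, if_pos hk, e]; rfl

lemma MM_mk (d : ℕ) (i : Fin d) (j : ℕ) (k : ℤ) (h : 0 < k.toNat) :
    MM d i j k = X (i, j, (⟨k.toNat, h⟩ : ℕ+)) := by
  have e : k.toNat.toPNat' = (⟨k.toNat, h⟩ : ℕ+) := by
    apply PNat.eq; simp [h]
  have hk : 0 < k := by omega
  rw [MM, if_pos hk, e]; rfl

lemma alg1 {R : Type*} [CommRing R] [Algebra ℂ R] (c e : ℂ) (dp dx q x dq M p : R) :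
    c • (dp + (dx * q + x * dq)) + e • (M * (p + x * q))
      = x * (c • dq + e • (M * q)) + ((c • dp + e • (M * p)) + c • (dx * q)) := by
  simp only [Algebra.smul_def]; ring

lemma pos_cases (k : ℤ) : k ≤ 0 ∨ ∃ a : ℕ+, k = ((a : ℕ) : ℤ) := by
  rcases le_or_gt k 0 with h | h
  · exact Or.inl h
  · exact Or.inr ⟨⟨k.toNat, by omega⟩, by simp; omega⟩

lemma DD_leib (d : ℕ) (i : Fin d) (j : ℕ) (k : ℤ) (p q : MvPolynomial (Fin d × ℕ × ℕ+) ℂ) :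
    DD d i j k (p * q) = DD d i j k p * q + p * DD d i j k q := by
  unfold DD
  split_ifs
  · simp [Derivation.leibniz]; ring
  · simp

lemma pderiv_comm' (d : ℕ) (v w : Fin d × ℕ × ℕ+) (p : MvPolynomial (Fin d × ℕ × ℕ+) ℂ) :
    pderiv v (pderiv w p) = pderiv w (pderiv v p) := by
  classical
  induction p using MvPolynomial.induction_on with
  | C a => simp
  | add p q hp hq => simp [hp, hq]
  | mul_X p u hp =>
    simp only [Derivation.leibniz, map_add, smul_eq_mul, pderiv_X, hp]
    have hs : ∀ a b : Fin d × ℕ × ℕ+,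
        pderiv a ((Pi.single b 1 : Fin d × ℕ × ℕ+ → MvPolynomial (Fin d × ℕ × ℕ+) ℂ) u) = 0 := by
      intro a b
      rw [Pi.single_apply]; split_ifs <;> simp
    rw [hs, hs]; ring

lemma DD_comm (d : ℕ) (i : Fin d) (j : ℕ) (k : ℤ) (w : Fin d × ℕ × ℕ+)
    (p : MvPolynomial (Fin d × ℕ × ℕ+) ℂ) :
    DD d i j k (pderiv w p) = pderiv w (DD d i j k p) := by
  unfold DD
  split_ifs
  · simp [pderiv_comm' d w]
  · simp

lemma DD_X (d : ℕ) (i : Fin d) (j : ℕ) (k : ℤ) (w : Fin d × ℕ × ℕ+) :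
    DD d i j k (X w) = if i = w.1 ∧ j = w.2.1 ∧ k = ((w.2.2 : ℕ) : ℤ) then 1 else 0 := by
  classical
  obtain ⟨a, b, c⟩ := w
  rcases pos_cases k with h | ⟨e, rfl⟩
  · have : (0 : ℤ) < ((c : ℕ) : ℤ) := by exact_mod_cast c.pos
    rw [DD_neg _ _ _ _ h, if_neg (by simp; omega)]; rfl
  · rw [DD_pos, pderiv_X, Pi.single_apply]
    congr 1
    simp [eq_comm]

lemma pderiv_MM (d : ℕ) (i : Fin d) (j : ℕ) (k : ℤ) (w : Fin d × ℕ × ℕ+) :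
    pderiv w (MM d i j k) = if i = w.1 ∧ j = w.2.1 ∧ k = ((w.2.2 : ℕ) : ℤ) then 1 else 0 := by
  classical
  obtain ⟨a, b, c⟩ := w
  rcases pos_cases k with h | ⟨e, rfl⟩
  · have : (0 : ℤ) < ((c : ℕ) : ℤ) := by exact_mod_cast c.pos
    rw [MM_neg _ _ _ _ h, if_neg (by simp; omega)]; simp
  · rw [MM_pos, pderiv_X, Pi.single_apply]
    congr 1
    simp

/-- the summand of `L(n)` -/
noncomputable def TT (d : ℕ) (l : ℂ) (n : ℤ) (v : Fin d × ℕ × ℕ+)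
    (p : MvPolynomial (Fin d × ℕ × ℕ+) ℂ) : MvPolynomial (Fin d × ℕ × ℕ+) ℂ :=
  (l / 2 * ((n - (v.2.2 : ℕ)) * (v.2.2 : ℕ))) •
      DD d v.1 v.2.1 (n - ((v.2.2 : ℕ) : ℤ)) (pderiv v p)
    + ((v.2.2 : ℕ) : ℂ) • (MM d v.1 v.2.1 (((v.2.2 : ℕ) : ℤ) - n) * pderiv v p)

lemma TT_add (d : ℕ) (l : ℂ) (n : ℤ) (v : Fin d × ℕ × ℕ+)
    (p q : MvPolynomial (Fin d × ℕ × ℕ+) ℂ) : TT d l n v (p + q) = TT d l n v p + TT d l n v q := by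
  simp only [TT, map_add, smul_add, mul_add]; abel

lemma TT_smul (d : ℕ) (l : ℂ) (n : ℤ) (v : Fin d × ℕ × ℕ+) (c : ℂ)
    (p : MvPolynomial (Fin d × ℕ × ℕ+) ℂ) : TT d l n v (c • p) = c • TT d l n v p := by
  simp only [TT, Derivation.map_smul, map_smul, smul_add, mul_smul_comm]
  rw [smul_comm, smul_comm c (_ : ℂ) (MM _ _ _ _ * _)]

lemma Ln_mono (d : ℕ) (l : ℂ) (n : ℤ) (e : (Fin d × ℕ × ℕ+) →₀ ℕ) :
    Ln d l n (monomial e 1) = ∑ v ∈ e.support, TT d l n v (monomial e 1) := by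
  have h : Ln d l n (monomial e 1) = LnMono d l n e := by
    have := (basisMonomials (Fin d × ℕ × ℕ+) ℂ).constr_basis ℂ (LnMono d l n) e
    rwa [coe_basisMonomials] at this
  rw [h, LnMono, Finset.smul_sum, ← Finset.sum_add_distrib]
  refine Finset.sum_congr rfl fun v _ => ?_
  unfold TT
  congr 1
  · by_cases h : ((v.2.2 : ℕ) : ℤ) < n
    · rw [dif_pos h, smul_smul, DD_mk _ _ _ _ (by omega)]
      push_cast
      rfl
    · rw [dif_neg h, DD_neg _ _ _ _ (by omega)]; simp
  · by_cases h : n < ((v.2.2 : ℕ) : ℤ)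
    · rw [dif_pos h, MM_mk _ _ _ _ (by omega)]
      push_cast
      rfl
    · rw [dif_neg h, MM_neg _ _ _ _ (by omega)]; simp

lemma Ln_ev (d : ℕ) (l : ℂ) (n : ℤ) (p : MvPolynomial (Fin d × ℕ × ℕ+) ℂ) :
    ∀ᶠ S : Finset (Fin d × ℕ × ℕ+) in Filter.atTop, Ln d l n p = ∑ v ∈ S, TT d l n v p := by
  induction p using MvPolynomial.induction_on' with
  | monomial e b =>
    filter_upwards [Filter.eventually_ge_atTop e.support] with S hle
    have h1 : (monomial e b : MvPolynomial (Fin d × ℕ × ℕ+) ℂ) = b • monomial e 1 := by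
      rw [smul_monomial]; simp
    rw [h1, map_smul, Ln_mono]
    simp only [TT_smul]
    rw [← Finset.smul_sum]
    congr 1
    refine Finset.sum_subset hle fun v _ hv => ?_
    have : e v = 0 := by simpa using hv
    simp [TT, pderiv_monomial, this]
  | add p q hp hq =>
    filter_upwards [hp, hq] with S h1 h2
    simp only [TT_add, Finset.sum_add_distrib, map_add, h1, h2]

/-- the Heisenberg operators -/
noncomputable def AA (d : ℕ) (l : ℂ) (i : Fin d) (j : ℕ) (k : ℤ)
    (p : MvPolynomial (Fin d × ℕ × ℕ+) ℂ) : MvPolynomial (Fin d × ℕ × ℕ+) ℂ :=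
  (l * k) • DD d i j k p + MM d i j (-k) * p

lemma sum_pick (d : ℕ) (S : Finset (Fin d × ℕ × ℕ+)) (i : Fin d) (j : ℕ) (k : ℤ)
    (hS : ∀ a : ℕ+, k = ((a : ℕ) : ℤ) → (i, j, a) ∈ S)
    (c : ℂ) (p : MvPolynomial (Fin d × ℕ × ℕ+) ℂ)
    (F : Fin d × ℕ × ℕ+ → MvPolynomial (Fin d × ℕ × ℕ+) ℂ)
    (h0 : ∀ v, ¬ (v.1 = i ∧ v.2.1 = j ∧ ((v.2.2 : ℕ) : ℤ) = k) → F v = 0)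
    (h1 : ∀ v, v.1 = i → v.2.1 = j → ((v.2.2 : ℕ) : ℤ) = k → F v = c • pderiv v p) :
    ∑ v ∈ S, F v = c • DD d i j k p := by
  rcases pos_cases k with h | ⟨a, rfl⟩
  · rw [DD_neg _ _ _ _ h, Finset.sum_eq_zero]
    · simp
    · intro v _
      apply h0
      have : (0 : ℤ) < ((v.2.2 : ℕ) : ℤ) := by exact_mod_cast v.2.2.pos
      omega
  · rw [DD_pos, Finset.sum_eq_single (i, j, a)]
    · exact h1 _ rfl rfl rfl
    · rintro ⟨x, y, z⟩ _ hv
      apply h0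
      simpa using hv
    · intro h; exact absurd (hS a rfl) h

lemma ev_mem (d : ℕ) (i : Fin d) (j : ℕ) (k : ℤ) :
    ∀ᶠ S : Finset (Fin d × ℕ × ℕ+) in Filter.atTop,
      ∀ a : ℕ+, k = ((a : ℕ) : ℤ) → (i, j, a) ∈ S := by
  rcases pos_cases k with h | ⟨a, rfl⟩
  · refine Filter.Eventually.of_forall fun S a ha => ?_
    have : (0 : ℤ) < ((a : ℕ) : ℤ) := by exact_mod_cast a.pos
    omega
  · filter_upwards [Filter.eventually_ge_atTop {(i, j, a)}] with S hS b hb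
    have : a = b := by
      apply PNat.eq; exact_mod_cast hb
    subst this
    exact hS (by simp)

lemma Ln_X (d : ℕ) (l : ℂ) (n : ℤ) (i : Fin d) (j : ℕ) (k : ℕ+)
    (p : MvPolynomial (Fin d × ℕ × ℕ+) ℂ) :
    Ln d l n (X (i, j, k) * p) = X (i, j, k) * Ln d l n p
      + ((k : ℕ) : ℂ) • AA d l i j (n - ((k : ℕ) : ℤ)) p := by
  classical
  obtain ⟨S, h1, h2, h3, h4⟩ := ((Ln_ev d l n p).and ((Ln_ev d l n (X (i, j, k) * p)).and
    ((ev_mem d i j (n - ((k : ℕ) : ℤ))).and (Filter.eventually_ge_atTop {(i, j, k)})))).exists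
  have h4 : (i, j, k) ∈ S := h4 (by simp)
  have key : ∀ v, TT d l n v (X (i, j, k) * p) = X (i, j, k) * TT d l n v p
      + ((if v = (i, j, k) then (l / 2 * ((n - (k : ℕ)) * (k : ℕ))) •
            DD d i j (n - ((k : ℕ) : ℤ)) p
          + ((k : ℕ) : ℂ) • (MM d i j (((k : ℕ) : ℤ) - n) * p) else 0)
        + (if v.1 = i ∧ v.2.1 = j ∧ n - ((v.2.2 : ℕ) : ℤ) = ((k : ℕ) : ℤ) then
            (l / 2 * ((n - (k : ℕ)) * (k : ℕ))) • pderiv v p else 0)) := by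
    intro v
    have e1 : pderiv v (X (i, j, k) * p) = (if v = (i, j, k) then p else 0)
        + X (i, j, k) * pderiv v p := by
      rw [Derivation.leibniz, pderiv_X, Pi.single_apply]
      by_cases h : v = (i, j, k)
      · simp [h]; ring
      · simp [h, Ne.symm h]
    have e2 : (if v.1 = i ∧ v.2.1 = j ∧ n - ((v.2.2 : ℕ) : ℤ) = ((k : ℕ) : ℤ) then
            (l / 2 * ((n - (k : ℕ)) * (k : ℕ))) • pderiv v p else 0)
        = (l / 2 * ((n - (v.2.2 : ℕ)) * (v.2.2 : ℕ))) •
          ((DD d v.1 v.2.1 (n - ((v.2.2 : ℕ) : ℤ)) (X (i, j, k))) * pderiv v p) := by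
      rw [DD_X]
      by_cases h : v.1 = i ∧ v.2.1 = j ∧ n - ((v.2.2 : ℕ) : ℤ) = ((k : ℕ) : ℤ)
      · rw [if_pos h, if_pos h, one_mul]
        have hn : (n : ℂ) = (k : ℕ) + (v.2.2 : ℕ) := by
          have : n = ((k : ℕ) : ℤ) + ((v.2.2 : ℕ) : ℤ) := by omega
          rw [this]; push_cast; rfl
        rw [hn]; congr 1; ring
      · rw [if_neg h, if_neg h]; simp
    rw [e2]
    unfold TT
    rw [e1, map_add, DD_leib]
    by_cases h : v = (i, j, k)
    · subst h
      rw [if_pos rfl, if_pos rfl]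
      exact alg1 _ _ _ _ _ _ _ _ _
    · rw [if_neg h, if_neg h, map_zero, alg1]
      simp
  rw [h2, h1]
  simp only [key, Finset.sum_add_distrib]
  rw [← Finset.mul_sum, Finset.sum_ite_eq', if_pos h4,
    sum_pick d S i j (n - ((k : ℕ) : ℤ)) h3 (l / 2 * ((n - (k : ℕ)) * (k : ℕ))) p
      (fun v => if v.1 = i ∧ v.2.1 = j ∧ n - ((v.2.2 : ℕ) : ℤ) = ((k : ℕ) : ℤ) then
            (l / 2 * ((n - (k : ℕ)) * (k : ℕ))) • pderiv v p else 0)]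
  · unfold AA
    rw [neg_sub, smul_add, smul_smul]
    push_cast
    rw [add_right_comm (_ • DD _ _ _ _ _) _ (_ • DD _ _ _ _ _), ← add_smul]
    congr 3
    ring
  · intro v hv
    refine if_neg ?_
    rintro ⟨a, b, c⟩
    exact hv ⟨a, b, by omega⟩
  · intro v a b c
    exact if_pos ⟨a, b, by omega⟩

lemma Ln_D (d : ℕ) (l : ℂ) (n : ℤ) (i : Fin d) (j : ℕ) (k : ℕ+)
    (p : MvPolynomial (Fin d × ℕ × ℕ+) ℂ) :
    Ln d l n (pderiv (i, j, k) p) = pderiv (i, j, k) (Ln d l n p)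
      - ((n : ℂ) + (k : ℕ)) • DD d i j (n + ((k : ℕ) : ℤ)) p := by
  classical
  obtain ⟨S, h1, h2, h3⟩ := ((Ln_ev d l n p).and ((Ln_ev d l n (pderiv (i, j, k) p)).and
    (ev_mem d i j (n + ((k : ℕ) : ℤ))))).exists
  have key : ∀ v, TT d l n v (pderiv (i, j, k) p) = pderiv (i, j, k) (TT d l n v p)
      - (if v.1 = i ∧ v.2.1 = j ∧ ((v.2.2 : ℕ) : ℤ) - n = ((k : ℕ) : ℤ) then
            ((n : ℂ) + (k : ℕ)) • pderiv v p else 0) := by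
    intro v
    unfold TT
    rw [map_add, Derivation.map_smul, Derivation.map_smul, Derivation.leibniz, pderiv_MM,
      pderiv_comm' d v, DD_comm]
    by_cases h : v.1 = i ∧ v.2.1 = j ∧ ((v.2.2 : ℕ) : ℤ) - n = ((k : ℕ) : ℤ)
    · have hn : (n : ℂ) + (k : ℕ) = (v.2.2 : ℕ) := by
        have : ((v.2.2 : ℕ) : ℤ) = n + ((k : ℕ) : ℤ) := by omega
        exact_mod_cast this.symm
      rw [if_pos h, if_pos h, hn]
      simp only [smul_eq_mul, mul_one, smul_add]
      rw [← add_assoc, add_sub_cancel_right]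
    · rw [if_neg h, if_neg h]
      simp
  rw [h2, h1]
  simp only [key, Finset.sum_sub_distrib, map_sum]
  congr 1
  refine sum_pick d S i j _ h3 _ p _ ?_ ?_
  · intro v hv
    rw [if_neg]
    rintro ⟨a, b, c⟩
    exact hv ⟨a, b, by omega⟩
  · intro v a b c
    rw [if_pos ⟨a, b, by omega⟩]

lemma Ln_A (d : ℕ) (l : ℂ) (n : ℤ) (hn : -1 ≤ n) (i : Fin d) (j : ℕ) (k : ℤ)
    (p : MvPolynomial (Fin d × ℕ × ℕ+) ℂ) :
    Ln d l n (AA d l i j k p) = AA d l i j k (Ln d l n p) - (k : ℂ) • AA d l i j (n + k) p := by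
  rcases pos_cases k with h | ⟨a, rfl⟩
  · rcases pos_cases (-k) with h' | ⟨a, ha⟩
    · have : k = 0 := by omega
      subst this
      simp [AA, MM_neg]
    · have : k = -((a : ℕ) : ℤ) := by omega
      subst this
      have e : ∀ q, AA d l i j (-((a : ℕ) : ℤ)) q = X (i, j, a) * q := by
        intro q
        rw [AA, DD_neg _ _ _ _ h, neg_neg, MM_pos]; simp
      rw [e, e, Ln_X]
      push_cast
      rw [neg_smul, sub_neg_eq_add, ← sub_eq_add_neg]
  · have hp : (0 : ℤ) < ((a : ℕ) : ℤ) := by exact_mod_cast a.pos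
    have e : ∀ q, AA d l i j (((a : ℕ) : ℤ)) q = (l * (a : ℕ)) • pderiv (i, j, a) q := by
      intro q
      rw [AA, DD_pos, MM_neg _ _ _ _ (by omega)]; simp
    rw [e, e, map_smul, Ln_D, smul_sub, AA, MM_neg _ _ _ _ (by omega), zero_mul, add_zero,
      smul_smul, smul_smul]
    push_cast
    congr 2
    ring

/-- Theorem 3.3: the operators `L(n)`, `n ≥ -1`, satisfy the Virasoro relations
without central term: `[L(m), L(n)] = (m-n)·L(m+n)`; hence `M(l)` is quasi-conformal. -/
theorem statement7 (d : ℕ) (hd : 0 < d) (l : ℂ) (hl : l ≠ 0)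
    (m n : ℤ) (hm : -1 ≤ m) (hn : -1 ≤ n) :
    Ln d l m * Ln d l n - Ln d l n * Ln d l m
      = ((m - n : ℤ) : ℂ) • Ln d l (m + n) := by
  by_cases hmn : m = n
  · subst hmn; simp
  have h1 : ∀ r a, Ln d l r (C a) = 0 := by
    intro r a
    obtain ⟨S, hS⟩ := (Ln_ev d l r (C a)).exists
    rw [hS]
    exact Finset.sum_eq_zero fun v _ => by simp [TT]
  refine LinearMap.ext fun p => ?_
  simp only [LinearMap.sub_apply, Module.End.mul_apply, LinearMap.smul_apply]
  induction p using MvPolynomial.induction_on with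
  | C a => simp [h1]
  | add p q hp hq =>
    simp only [map_add, smul_add, ← hp, ← hq]; abel
  | mul_X p v hp =>
    obtain ⟨i, j, k⟩ := v
    rw [mul_comm p]
    have hA : ∀ r s, AA d l i j (r + (s - ((k : ℕ) : ℤ))) p
        = AA d l i j (r + s - ((k : ℕ) : ℤ)) p := by
      intro r s; rw [add_sub_assoc]
    simp only [Ln_X, map_add, map_smul, Ln_A d l m hm, Ln_A d l n hn, hA, add_comm n m]
    have hp' := sub_eq_iff_eq_add.mp hp
    rw [hp']
    simp only [mul_add, mul_smul_comm, smul_add, smul_sub, smul_smul]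
    push_cast
    module
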